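/- arXiv:1802.06269 — 3 statements merged into one kernel-verified Lean document; each statement's English description precedes it below -/
import Mathlib

section
/- Let 0 < α < 2 and β > 0, and let μ satisfy πα/2 < μ < min{π, πα}. Then there exists a constant C = C(α, β, μ) > 0 such that |E_{α,β}(z)| ≤ C/(1 + |z|) for every nonzero z ∈ ℂ with μ ≤ |arg z| ≤ π. -/
/-- The Mittag-Leffler function `E_{α,β}(z) = ∑_{k=0}^∞ z^k / Γ(αk + β)`. -/
noncomputable def mittagLeffler (α β : ℝ) (z : ℂ) : ℂ :=
  ∑' k : ℕ, z ^ k / Complex.Gamma ((α * (k : ℝ) + β : ℝ) : ℂ)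

open MeasureTheory Set Filter Topology

theorem integrableOn_rpow_mul_exp_neg_mul {s r : ℝ} (hs : 0 < s) (hr : 0 < r) :
    IntegrableOn (fun x : ℝ ↦ x ^ (s - 1) * Real.exp (-(r * x))) (Ioi 0) := by
  have h := integrableOn_rpow_mul_exp_neg_mul_rpow (p := 1) (s := s - 1) (b := r) (by linarith)
    one_pos hr
  simpa using h

theorem norm_ofReal_cpow_mul_exp {s x : ℝ} (u : ℂ) (hx : 0 < x) :
    ‖(x : ℂ) ^ ((s : ℂ) - 1) * Complex.exp (-(u * x))‖ = x ^ (s - 1) * Real.exp (-(u.re * x)) := by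
  rw [norm_mul, Complex.norm_cpow_eq_rpow_re_of_pos hx, Complex.norm_exp]
  simp

theorem aestronglyMeasurable_cpow_mul_exp (s : ℝ) (u : ℂ) :
    AEStronglyMeasurable (fun x : ℝ ↦ (x : ℂ) ^ ((s : ℂ) - 1) * Complex.exp (-(u * x)))
      (volume.restrict (Ioi 0)) := by
  refine ContinuousOn.aestronglyMeasurable (fun x hx ↦ ?_) measurableSet_Ioi
  refine ContinuousAt.continuousWithinAt (ContinuousAt.mul ?_ (by fun_prop))
  exact Complex.continuousAt_ofReal_cpow_const _ _ (Or.inr (ne_of_gt hx))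

theorem integrableOn_cpow_mul_exp {s : ℝ} {u : ℂ} (hs : 0 < s) (hu : 0 < u.re) :
    IntegrableOn (fun x : ℝ ↦ (x : ℂ) ^ ((s : ℂ) - 1) * Complex.exp (-(u * x))) (Ioi 0) := by
  refine (integrableOn_rpow_mul_exp_neg_mul hs hu).mono' (aestronglyMeasurable_cpow_mul_exp s u) ?_
  filter_upwards [ae_restrict_mem measurableSet_Ioi] with x hx
  exact (norm_ofReal_cpow_mul_exp u hx).le

theorem differentiableAt_laplace_cpow {s : ℝ} {u : ℂ} (hs : 0 < s) (hu : 0 < u.re) :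
    DifferentiableAt ℂ
      (fun u : ℂ ↦ ∫ x : ℝ in Ioi 0, (x : ℂ) ^ ((s : ℂ) - 1) * Complex.exp (-(u * x))) u := by
  have key := hasDerivAt_integral_of_dominated_loc_of_deriv_le (μ := volume.restrict (Ioi (0 : ℝ)))
    (F := fun (u : ℂ) (x : ℝ) ↦ (x : ℂ) ^ ((s : ℂ) - 1) * Complex.exp (-(u * x)))
    (F' := fun (u : ℂ) (x : ℝ) ↦ -((x : ℂ) ^ (((s + 1 : ℝ) : ℂ) - 1) * Complex.exp (-(u * x))))
    (bound := fun x ↦ x ^ (s + 1 - 1) * Real.exp (-(u.re / 2 * x)))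
    (s := {v : ℂ | u.re / 2 < v.re}) (x₀ := u)
    ((isOpen_lt continuous_const Complex.continuous_re).mem_nhds (by simp; linarith))
    (Eventually.of_forall fun v ↦ aestronglyMeasurable_cpow_mul_exp s v)
    (integrableOn_cpow_mul_exp hs hu)
    (aestronglyMeasurable_cpow_mul_exp (s + 1) u).neg ?_
    (integrableOn_rpow_mul_exp_neg_mul (by linarith) (by linarith)) ?_
  · exact key.2.differentiableAt
  · filter_upwards [ae_restrict_mem measurableSet_Ioi] with x hx v hv
    rw [norm_neg, norm_ofReal_cpow_mul_exp v hx]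
    have hx' : 0 < x := hx
    have hv' : u.re / 2 < v.re := hv
    gcongr
  · filter_upwards [ae_restrict_mem measurableSet_Ioi] with x hx v hv
    have hx' : (x : ℂ) ≠ 0 := Complex.ofReal_ne_zero.mpr (ne_of_gt hx)
    have h1 : HasDerivAt (fun v : ℂ ↦ Complex.exp (-(v * x))) (Complex.exp (-(v * x)) * -(1 * x)) v :=
      (((hasDerivAt_id v).mul_const (x : ℂ)).neg).cexp
    have h2 : (x : ℂ) ^ (((s + 1 : ℝ) : ℂ) - 1) = (x : ℂ) ^ ((s : ℂ) - 1) * x := by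
      nth_rewrite 3 [← Complex.cpow_one (x : ℂ)]
      rw [← Complex.cpow_add _ _ hx']
      congr 1
      push_cast
      ring
    refine (h1.const_mul ((x : ℂ) ^ ((s : ℂ) - 1))).congr_deriv ?_
    rw [h2]
    ring

/-- The Laplace transform of `x ^ (s - 1)` on the right half-plane. -/
theorem laplace_cpow {s : ℝ} {u : ℂ} (hs : 0 < s) (hu : 0 < u.re) :
    ∫ x : ℝ in Ioi 0, (x : ℂ) ^ ((s : ℂ) - 1) * Complex.exp (-(u * x)) =
      u ^ (-(s : ℂ)) * Complex.Gamma s := by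
  have hU : IsOpen {v : ℂ | 0 < v.re} := isOpen_lt continuous_const Complex.continuous_re
  have hf : AnalyticOnNhd ℂ
      (fun u : ℂ ↦ ∫ x : ℝ in Ioi 0, (x : ℂ) ^ ((s : ℂ) - 1) * Complex.exp (-(u * x)))
      {v : ℂ | 0 < v.re} :=
    DifferentiableOn.analyticOnNhd
      (fun v hv ↦ (differentiableAt_laplace_cpow hs hv).differentiableWithinAt) hU
  have hg : AnalyticOnNhd ℂ (fun u : ℂ ↦ u ^ (-(s : ℂ)) * Complex.Gamma s) {v : ℂ | 0 < v.re} :=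
    DifferentiableOn.analyticOnNhd (fun v hv ↦ by
      refine ((differentiableAt_id.cpow_const (Or.inl hv)).mul_const _).differentiableWithinAt) hU
  refine hf.eqOn_of_preconnected_of_frequently_eq hg
    (convex_halfSpace_re_gt 0).isPreconnected (z₀ := ((1 : ℝ) : ℂ)) (by simp) ?_ hu
  have ht : Tendsto (fun r : ℝ ↦ (r : ℂ)) (𝓝[≠] 1) (𝓝[≠] ((1 : ℝ) : ℂ)) :=
    tendsto_nhdsWithin_of_tendsto_nhds_of_eventually_within _
      (Complex.continuous_ofReal.continuousAt.mono_left nhdsWithin_le_nhds)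
      (by filter_upwards [self_mem_nhdsWithin] with r hr using by simpa using hr)
  refine ht.frequently (Eventually.frequently ?_)
  filter_upwards [nhdsWithin_le_nhds (lt_mem_nhds (zero_lt_one (α := ℝ)))] with r hr
  rw [Complex.integral_cpow_mul_exp_neg_mul_Ioi (by simpa using hs) hr, Complex.cpow_neg, one_div,
    Complex.inv_cpow _ _ (by simp [Complex.arg_ofReal_of_nonneg hr.le, Real.pi_ne_zero.symm])]

/-- A parametrization of the vertical line `re u = 1`. -/
noncomputable def vline (ξ : ℝ) : ℂ := 1 + 2 * Real.pi * ξ * Complex.I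

theorem vline_re (ξ : ℝ) : (vline ξ).re = 1 := by simp [vline]

theorem vline_im (ξ : ℝ) : (vline ξ).im = 2 * Real.pi * ξ := by simp [vline]

theorem vline_ne_zero (ξ : ℝ) : vline ξ ≠ 0 := fun h ↦ by
  simpa [h] using vline_re ξ

theorem one_le_norm_vline (ξ : ℝ) : 1 ≤ ‖vline ξ‖ := by
  simpa [vline_re] using Complex.abs_re_le_norm (vline ξ)

theorem one_add_abs_le_norm_vline (ξ : ℝ) : (1 + |ξ|) / 2 ≤ ‖vline ξ‖ := by
  have h1 := one_le_norm_vline ξ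
  have h2 := Complex.abs_im_le_norm (vline ξ)
  rw [vline_im, abs_mul, abs_of_pos Real.two_pi_pos] at h2
  nlinarith [Real.pi_gt_three, abs_nonneg ξ]

theorem vline_mem_slitPlane (ξ : ℝ) : vline ξ ∈ Complex.slitPlane :=
  Or.inl (by simp [vline_re])

theorem continuous_vline : Continuous vline := by
  unfold vline
  fun_prop

theorem continuous_vline_cpow (s : ℂ) : Continuous fun ξ ↦ vline ξ ^ s :=
  continuous_vline.cpow continuous_const vline_mem_slitPlane

theorem norm_vline_cpow (ξ s : ℝ) : ‖vline ξ ^ (s : ℂ)‖ = ‖vline ξ‖ ^ s := by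
  rw [Complex.norm_cpow_of_ne_zero (vline_ne_zero ξ)]
  simp

theorem integrable_norm_vline_rpow {s : ℝ} (hs : 1 < s) :
    Integrable fun ξ ↦ ‖vline ξ‖ ^ (-s) := by
  have h := (integrable_one_add_norm (E := ℝ) (μ := volume) (r := s) (by simpa using hs)).const_mul
    ((2 : ℝ) ^ s)
  refine h.mono' ?_ (Eventually.of_forall fun ξ ↦ ?_)
  · refine Continuous.aestronglyMeasurable ?_
    exact (continuous_vline.norm).rpow_const fun ξ ↦ Or.inl (norm_ne_zero_iff.mpr (vline_ne_zero ξ))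
  · rw [Real.norm_of_nonneg (by positivity)]
    have h1 : ‖vline ξ‖ ^ (-s) ≤ ((1 + |ξ|) / 2) ^ (-s) :=
      Real.rpow_le_rpow_of_nonpos (by positivity) (one_add_abs_le_norm_vline ξ) (by linarith)
    refine h1.trans (le_of_eq ?_)
    rw [Real.div_rpow (by positivity) (by norm_num), Real.rpow_neg (x := 2) (by norm_num),
      div_inv_eq_mul, mul_comm, Real.norm_eq_abs]

theorem integrable_vline_cpow {s : ℝ} (hs : 1 < s) :
    Integrable fun ξ ↦ vline ξ ^ (-(s : ℂ)) := by
  refine (integrable_norm_vline_rpow hs).mono' (continuous_vline_cpow _).aestronglyMeasurable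
    (Eventually.of_forall fun ξ ↦ ?_)
  rw [← norm_vline_cpow, Complex.ofReal_neg]

/-- Laplace inversion for `x ^ (s - 1)`. -/
theorem integral_exp_mul_vline_cpow {s x : ℝ} (hs : 1 < s) (hx : 0 < x) :
    ∫ ξ, Complex.exp (x * vline ξ) * vline ξ ^ (-(s : ℂ)) =
      (x : ℂ) ^ ((s : ℂ) - 1) / Complex.Gamma s := by
  have hΓ : Complex.Gamma s ≠ 0 := Complex.Gamma_ne_zero_of_re_pos (by simp; linarith)
  set f : ℝ → ℂ := (Ioi 0).indicator
    fun x : ℝ ↦ (x : ℂ) ^ ((s : ℂ) - 1) * Complex.exp (-((1 : ℂ) * x)) with hf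
  have hfi : Integrable f :=
    (integrable_indicator_iff measurableSet_Ioi).2
      (integrableOn_cpow_mul_exp (by linarith) (by simp))
  have hft : ∀ ξ, FourierTransform.fourier f ξ = vline ξ ^ (-(s : ℂ)) * Complex.Gamma s := by
    intro ξ
    rw [← laplace_cpow (by linarith) (by simp [vline_re]), Real.fourier_real_eq_integral_exp_smul,
      ← integral_indicator measurableSet_Ioi]
    congr 1 with y
    by_cases hy : y ∈ Ioi (0 : ℝ)
    · simp only [hf, indicator_of_mem hy, smul_eq_mul]
      rw [mul_left_comm, ← Complex.exp_add]
      congr 2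
      simp only [vline]
      push_cast
      ring
    · simp [hf, indicator_of_notMem hy]
  have hfti : Integrable (FourierTransform.fourier f) := by
    rw [show FourierTransform.fourier f = fun ξ ↦ vline ξ ^ (-(s : ℂ)) * Complex.Gamma s from
      funext hft]
    exact (integrable_vline_cpow hs).mul_const _
  have hfc : ContinuousAt f x := by
    have : f =ᶠ[𝓝 x] fun x : ℝ ↦ (x : ℂ) ^ ((s : ℂ) - 1) * Complex.exp (-((1 : ℂ) * x)) := by
      filter_upwards [lt_mem_nhds hx] with y hy
      exact indicator_of_mem (s := Ioi (0 : ℝ)) hy _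
    rw [continuousAt_congr this]
    exact (Complex.continuousAt_ofReal_cpow_const _ _ (Or.inr hx.ne')).mul (by fun_prop)
  have key := hfi.fourierInv_fourier_eq hfti hfc
  rw [Real.fourierInv_eq'] at key
  simp only [hft, smul_eq_mul] at key
  have hfx : f x = (x : ℂ) ^ ((s : ℂ) - 1) * Complex.exp (-((1 : ℂ) * x)) :=
    indicator_of_mem (s := Ioi (0 : ℝ)) hx _
  have hexp : ∀ ξ : ℝ, Complex.exp (x * vline ξ) * vline ξ ^ (-(s : ℂ)) =
      Complex.exp x / Complex.Gamma s *
        (Complex.exp (((2 * Real.pi * inner ℝ ξ x : ℝ) : ℂ) * Complex.I) *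
        (vline ξ ^ (-(s : ℂ)) * Complex.Gamma s)) := by
    intro ξ
    have : (x : ℂ) * vline ξ = x + ((2 * Real.pi * inner ℝ ξ x : ℝ) : ℂ) * Complex.I := by
      simp only [vline, real_inner_eq_re_inner]
      simp
      ring
    rw [this, Complex.exp_add]
    field_simp
  simp_rw [hexp]
  rw [integral_const_mul, key, hfx, one_mul, Complex.exp_neg]
  field_simp

theorem exists_inv_Gamma_le {β : ℝ} (hβ : 1 < β) :
    ∃ M, ∀ s x : ℝ, β ≤ s → 0 < x → (Real.Gamma s)⁻¹ ≤ M * Real.exp x * x ^ (1 - s) := by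
  refine ⟨∫ ξ, ‖vline ξ‖ ^ (-β), fun s x hs hx ↦ ?_⟩
  have hΓ : 0 < Real.Gamma s := Real.Gamma_pos_of_pos (by linarith)
  have h := integral_exp_mul_vline_cpow (s := s) (by linarith) hx
  have h1 : ‖(x : ℂ) ^ ((s : ℂ) - 1) / Complex.Gamma s‖ = x ^ (s - 1) * (Real.Gamma s)⁻¹ := by
    rw [norm_div, Complex.norm_cpow_eq_rpow_re_of_pos hx, Complex.Gamma_ofReal,
      Complex.norm_of_nonneg hΓ.le, div_eq_mul_inv]
    simp
  have h2 : x ^ (s - 1) * (Real.Gamma s)⁻¹ ≤ Real.exp x * ∫ ξ, ‖vline ξ‖ ^ (-β) := by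
    rw [← h1, ← h, ← integral_const_mul]
    refine norm_integral_le_of_norm_le ((integrable_norm_vline_rpow hβ).const_mul _)
      (Eventually.of_forall fun ξ ↦ ?_)
    rw [norm_mul, ← Complex.ofReal_neg, norm_vline_cpow, Complex.norm_exp, Complex.re_ofReal_mul,
      vline_re, mul_one]
    gcongr
    exact one_le_norm_vline ξ
  have h3 : x ^ (1 - s) * x ^ (s - 1) = 1 := by
    rw [← Real.rpow_add hx]
    simp
  calc (Real.Gamma s)⁻¹ = x ^ (1 - s) * (x ^ (s - 1) * (Real.Gamma s)⁻¹) := by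
        rw [← mul_assoc, h3, one_mul]
    _ ≤ x ^ (1 - s) * (Real.exp x * ∫ ξ, ‖vline ξ‖ ^ (-β)) := by gcongr
    _ = _ := by ring

theorem norm_mittagLeffler_term {α β : ℝ} (hα : 0 < α) (hβ : 0 < β) (z : ℂ) (k : ℕ) :
    ‖z ^ k / Complex.Gamma ((α * (k : ℝ) + β : ℝ) : ℂ)‖ =
      ‖z‖ ^ k * (Real.Gamma (α * k + β))⁻¹ := by
  have hΓ : 0 < Real.Gamma (α * k + β) := Real.Gamma_pos_of_pos (by positivity)
  rw [norm_div, norm_pow, Complex.Gamma_ofReal, Complex.norm_of_nonneg hΓ.le, div_eq_mul_inv]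

theorem summable_pow_mul_inv_Gamma {α β R : ℝ} (hα : 0 < α) (hβ : 0 < β) (hR : 0 < R) :
    Summable fun k : ℕ ↦ R ^ k * (Real.Gamma (α * k + β))⁻¹ := by
  have main : ∀ β : ℝ, 1 < β → Summable fun k : ℕ ↦ R ^ k * (Real.Gamma (α * k + β))⁻¹ := by
    intro β hβ
    obtain ⟨M, hM⟩ := exists_inv_Gamma_le hβ
    set x : ℝ := (2 * R) ^ (1 / α) with hx
    have hx0 : 0 < x := by positivity
    have hxα : x ^ α = 2 * R := by
      rw [hx, ← Real.rpow_mul (by positivity), one_div_mul_cancel hα.ne', Real.rpow_one]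
    refine Summable.of_nonneg_of_le (fun k ↦ ?_) (fun k ↦ ?_)
      ((summable_geometric_of_lt_one (r := 1 / 2) (by norm_num) (by norm_num)).mul_left
        (M * Real.exp x * x ^ (1 - β)))
    · have : 0 < Real.Gamma (α * k + β) := Real.Gamma_pos_of_pos (by positivity)
      positivity
    · have h := hM (α * k + β) x (le_add_of_nonneg_left (by positivity)) hx0
      have hk : x ^ (1 - (α * k + β)) = x ^ (1 - β) * ((2 * R) ^ k)⁻¹ := by
        rw [← hxα, ← Real.rpow_natCast, ← Real.rpow_mul hx0.le, ← Real.rpow_neg hx0.le,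
          ← Real.rpow_add hx0]
        congr 1
        ring
      calc R ^ k * (Real.Gamma (α * k + β))⁻¹
          ≤ R ^ k * (M * Real.exp x * x ^ (1 - (α * k + β))) := by gcongr
        _ = _ := by
          rw [hk, mul_pow, one_div, inv_pow]
          field_simp
  obtain ⟨N, hN⟩ := exists_nat_gt (1 / α)
  have hN' : 1 < α * N := by
    rw [div_lt_iff₀ hα] at hN
    linarith
  rw [← summable_nat_add_iff N]
  refine ((main (α * N + β) (by linarith)).mul_left (R ^ N)).congr fun k ↦ ?_
  push_cast
  rw [pow_add, show α * ((k : ℝ) + N) + β = α * k + (α * N + β) by ring]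
  ring

theorem norm_mittagLeffler_term_le {α β : ℝ} (hα : 0 < α) (hβ : 0 < β) {R : ℝ} (k : ℕ) {z : ℂ}
    (hz : z ∈ Metric.ball (0 : ℂ) R) :
    ‖z ^ k / Complex.Gamma ((α * (k : ℝ) + β : ℝ) : ℂ)‖ ≤
      R ^ k * (Real.Gamma (α * k + β))⁻¹ := by
  have hΓ : 0 < Real.Gamma (α * k + β) := Real.Gamma_pos_of_pos (by positivity)
  rw [norm_mittagLeffler_term hα hβ]
  gcongr
  exact (mem_ball_zero_iff.mp hz).le

theorem hasSum_mittagLeffler {α β : ℝ} (hα : 0 < α) (hβ : 0 < β) (z : ℂ) :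
    HasSum (fun k : ℕ ↦ z ^ k / Complex.Gamma ((α * (k : ℝ) + β : ℝ) : ℂ))
      (mittagLeffler α β z) :=
  (Summable.of_norm_bounded (summable_pow_mul_inv_Gamma hα hβ (R := ‖z‖ + 1) (by positivity))
    fun k ↦ norm_mittagLeffler_term_le hα hβ k (by simp)).hasSum

theorem differentiable_mittagLeffler {α β : ℝ} (hα : 0 < α) (hβ : 0 < β) :
    Differentiable ℂ (mittagLeffler α β) := fun z ↦
  (Complex.differentiableOn_tsum_of_summable_norm
    (summable_pow_mul_inv_Gamma hα hβ (R := ‖z‖ + 1) (by positivity))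
    (fun k ↦ by fun_prop) Metric.isOpen_ball
    fun k _ hw ↦ norm_mittagLeffler_term_le hα hβ k hw).differentiableAt
    (Metric.isOpen_ball.mem_nhds (by simp))

/-- The recurrence lowering the second parameter of the Mittag-Leffler function. -/
theorem mittagLeffler_eq_add_deriv {α β : ℝ} (hα : 0 < α) (hβ : 0 < β) (z : ℂ) :
    mittagLeffler α β z =
      β * mittagLeffler α (β + 1) z + α * z * deriv (mittagLeffler α (β + 1)) z := by
  have hβ' : 0 < β + 1 := by linarith
  have hd : HasSum (fun k : ℕ ↦
      deriv (fun w : ℂ ↦ w ^ k / Complex.Gamma ((α * (k : ℝ) + (β + 1) : ℝ) : ℂ)) z)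
      (deriv (mittagLeffler α (β + 1)) z) :=
    Complex.hasSum_deriv_of_summable_norm
      (summable_pow_mul_inv_Gamma hα hβ' (R := ‖z‖ + 1) (by positivity))
      (fun k ↦ by fun_prop) Metric.isOpen_ball
      (fun k _ hw ↦ norm_mittagLeffler_term_le hα hβ' k hw) (by simp)
  refine (hasSum_mittagLeffler hα hβ z).unique ?_
  refine (((hasSum_mittagLeffler hα hβ' z).mul_left (β : ℂ)).add
    (hd.mul_left (α * z : ℂ))).congr_fun fun k ↦ ?_
  have hpos : 0 < α * k + β := by positivity
  have hΓ : Complex.Gamma ((α * (k : ℝ) + β : ℝ) : ℂ) ≠ 0 :=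
    Complex.Gamma_ne_zero_of_re_pos (by simpa using hpos)
  have hne : ((α * (k : ℝ) + β : ℝ) : ℂ) ≠ 0 := Complex.ofReal_ne_zero.mpr hpos.ne'
  have hrec : Complex.Gamma ((α * (k : ℝ) + (β + 1) : ℝ) : ℂ) =
      ((α * (k : ℝ) + β : ℝ) : ℂ) * Complex.Gamma ((α * (k : ℝ) + β : ℝ) : ℂ) := by
    rw [← Complex.Gamma_add_one _ hne]
    congr 1
    push_cast
    ring
  have hz : z * (k * z ^ (k - 1)) = k * z ^ k := by
    cases k with
    | zero => simp
    | succ n => rw [Nat.add_sub_cancel, pow_succ]; ring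
  rw [deriv_div_const, deriv_pow_field, hrec]
  field_simp
  push_cast
  linear_combination (-(α : ℂ)) * hz

/-- The integrand representing the Mittag-Leffler function on the line `re u = 1`. -/
noncomputable def mittagLefflerKernel (α β : ℝ) (z : ℂ) (ξ : ℝ) : ℂ :=
  Complex.exp (vline ξ) * vline ξ ^ (-(β : ℂ)) / (1 - z * vline ξ ^ (-(α : ℂ)))

theorem norm_exp_mul_vline_cpow (β ξ : ℝ) :
    ‖Complex.exp (vline ξ) * vline ξ ^ (-(β : ℂ))‖ = Real.exp 1 * ‖vline ξ‖ ^ (-β) := by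
  rw [norm_mul, ← Complex.ofReal_neg, norm_vline_cpow, Complex.norm_exp, vline_re]

theorem norm_vline_cpow_neg_le_one {α : ℝ} (hα : 0 < α) (ξ : ℝ) :
    ‖vline ξ ^ (-(α : ℂ))‖ ≤ 1 := by
  rw [← Complex.ofReal_neg, norm_vline_cpow]
  exact Real.rpow_le_one_of_one_le_of_nonpos (one_le_norm_vline ξ) (by linarith)

theorem continuous_exp_mul_vline_cpow (β : ℝ) :
    Continuous fun ξ ↦ Complex.exp (vline ξ) * vline ξ ^ (-(β : ℂ)) :=
  continuous_vline.cexp.mul (continuous_vline_cpow _)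

theorem continuous_mittagLefflerKernel {α β : ℝ} {z : ℂ}
    (hz : ∀ ξ, 1 - z * vline ξ ^ (-(α : ℂ)) ≠ 0) : Continuous (mittagLefflerKernel α β z) :=
  (continuous_exp_mul_vline_cpow β).div
    (continuous_const.sub (continuous_const.mul (continuous_vline_cpow _))) hz

theorem mittagLeffler_eq_integral_of_norm_lt_one {α β : ℝ} (hα : 0 < α) (hβ : 1 < β) {z : ℂ}
    (hz : ‖z‖ < 1) : mittagLeffler α β z = ∫ ξ, mittagLefflerKernel α β z ξ := by
  set F : ℕ → ℝ → ℂ := fun k ξ ↦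
    z ^ k * (Complex.exp (vline ξ) * vline ξ ^ (-((α * (k : ℝ) + β : ℝ) : ℂ))) with hF
  have hbound : ∀ k ξ, ‖F k ξ‖ ≤ ‖z‖ ^ k * (Real.exp 1 * ‖vline ξ‖ ^ (-β)) := by
    intro k ξ
    rw [hF, norm_mul, norm_pow, norm_exp_mul_vline_cpow]
    gcongr
    · exact one_le_norm_vline ξ
    · exact le_add_of_nonneg_left (by positivity)
  have hint := (integrable_norm_vline_rpow hβ).const_mul (Real.exp 1)
  have hFi : ∀ k, Integrable (F k) := fun k ↦
    (hint.const_mul (‖z‖ ^ k)).mono'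
      (continuous_const.mul (continuous_exp_mul_vline_cpow _)).aestronglyMeasurable
      (Eventually.of_forall (hbound k))
  have hsum : Summable fun k ↦ ∫ ξ, ‖F k ξ‖ := by
    refine Summable.of_nonneg_of_le (fun k ↦ integral_nonneg fun ξ ↦ norm_nonneg _) (fun k ↦ ?_)
      ((summable_geometric_of_lt_one (norm_nonneg z) hz).mul_right
        (∫ ξ, Real.exp 1 * ‖vline ξ‖ ^ (-β)))
    rw [← integral_const_mul]
    exact integral_mono (hFi k).norm (hint.const_mul _) (hbound k)
  have key := hasSum_integral_of_summable_integral_norm hFi hsum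
  have hlhs : ∀ k, ∫ ξ, F k ξ = z ^ k / Complex.Gamma ((α * (k : ℝ) + β : ℝ) : ℂ) := by
    intro k
    have h := integral_exp_mul_vline_cpow (s := α * k + β) (x := 1)
      (hβ.trans_le (le_add_of_nonneg_left (by positivity))) one_pos
    simp only [Complex.ofReal_one, one_mul, Complex.one_cpow] at h
    rw [hF, integral_const_mul, h, mul_one_div]
  have hrhs : ∀ ξ, ∑' k, F k ξ = mittagLefflerKernel α β z ξ := by
    intro ξ
    have hr : ‖z * vline ξ ^ (-(α : ℂ))‖ < 1 := by
      rw [norm_mul]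
      exact (mul_le_of_le_one_right (norm_nonneg _) (norm_vline_cpow_neg_le_one hα ξ)).trans_lt hz
    rw [mittagLefflerKernel, div_eq_mul_inv, ← tsum_geometric_of_norm_lt_one hr, ← tsum_mul_left]
    congr 1 with k
    rw [hF, mul_pow, ← Complex.cpow_nat_mul]
    have : vline ξ ^ (-((α * (k : ℝ) + β : ℝ) : ℂ)) =
        vline ξ ^ (-(β : ℂ)) * vline ξ ^ ((k : ℂ) * -(α : ℂ)) := by
      rw [← Complex.cpow_add _ _ (vline_ne_zero ξ)]
      congr 1
      push_cast
      ring
    simp only [this]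
    ring
  simp only [hlhs, hrhs] at key
  exact (hasSum_mittagLeffler hα (by linarith) z).unique key

theorem analyticAt_integral_mittagLefflerKernel {α β δ : ℝ} (hα : 0 < α) (hβ : 1 < β)
    (hδ : 0 < δ) {z : ℂ} (hz : ∀ ξ, δ ≤ ‖1 - z * vline ξ ^ (-(α : ℂ))‖) :
    AnalyticAt ℂ (fun z ↦ ∫ ξ, mittagLefflerKernel α β z ξ) z := by
  have hball : ∀ w ∈ Metric.ball z (δ / 2), ∀ ξ, δ / 2 ≤ ‖1 - w * vline ξ ^ (-(α : ℂ))‖ := by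
    intro w hw ξ
    have h1 : ‖(w - z) * vline ξ ^ (-(α : ℂ))‖ ≤ δ / 2 := by
      rw [norm_mul]
      refine (mul_le_of_le_one_right (norm_nonneg _) (norm_vline_cpow_neg_le_one hα ξ)).trans ?_
      rw [← dist_eq_norm]
      exact (Metric.mem_ball.mp hw).le
    have h2 := norm_sub_norm_le (1 - z * vline ξ ^ (-(α : ℂ))) ((w - z) * vline ξ ^ (-(α : ℂ)))
    have h3 : 1 - z * vline ξ ^ (-(α : ℂ)) - (w - z) * vline ξ ^ (-(α : ℂ)) =
        1 - w * vline ξ ^ (-(α : ℂ)) := by ring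
    rw [h3] at h2
    linarith [hz ξ]
  have hne : ∀ w ∈ Metric.ball z (δ / 2), ∀ ξ, 1 - w * vline ξ ^ (-(α : ℂ)) ≠ 0 :=
    fun w hw ξ h ↦ by
      have := hball w hw ξ
      rw [h, norm_zero] at this
      linarith
  refine DifferentiableOn.analyticAt (s := Metric.ball z (δ / 2)) (fun w hw ↦ ?_)
    (Metric.ball_mem_nhds z (by linarith))
  have hint := (integrable_norm_vline_rpow hβ).const_mul (Real.exp 1)
  have hw' : Metric.ball z (δ / 2) ∈ 𝓝 w := Metric.isOpen_ball.mem_nhds hw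
  refine (hasDerivAt_integral_of_dominated_loc_of_deriv_le
    (F := fun v ξ ↦ mittagLefflerKernel α β v ξ)
    (F' := fun v ξ ↦ Complex.exp (vline ξ) * vline ξ ^ (-(β : ℂ)) *
      (vline ξ ^ (-(α : ℂ)) / (1 - v * vline ξ ^ (-(α : ℂ))) ^ 2))
    (bound := fun ξ ↦ Real.exp 1 * ‖vline ξ‖ ^ (-β) * (1 / (δ / 2) ^ 2))
    hw' ?_ ?_ ?_ ?_ (hint.mul_const _) ?_).2.differentiableAt.differentiableWithinAt
  · filter_upwards [hw'] with v hv
    exact (continuous_mittagLefflerKernel (hne v hv)).aestronglyMeasurable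
  · refine (hint.mul_const (1 / (δ / 2))).mono'
      (continuous_mittagLefflerKernel (hne w hw)).aestronglyMeasurable
      (Eventually.of_forall fun ξ ↦ ?_)
    rw [mittagLefflerKernel, norm_div, norm_exp_mul_vline_cpow, mul_one_div]
    gcongr
    exact hball w hw ξ
  · refine Continuous.aestronglyMeasurable ?_
    exact (continuous_exp_mul_vline_cpow β).mul ((continuous_vline_cpow _).div
      ((continuous_const.sub (continuous_const.mul (continuous_vline_cpow _))).pow 2)
      fun ξ ↦ pow_ne_zero 2 (hne w hw ξ))
  · refine Eventually.of_forall fun ξ v hv ↦ ?_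
    rw [norm_mul, norm_exp_mul_vline_cpow, norm_div, norm_pow]
    gcongr
    · exact norm_vline_cpow_neg_le_one hα ξ
    · exact hball v hv ξ
  · refine Eventually.of_forall fun ξ v hv ↦ ?_
    have h1 : HasDerivAt (fun v : ℂ ↦ 1 - v * vline ξ ^ (-(α : ℂ)))
        (-(1 * vline ξ ^ (-(α : ℂ)))) v :=
      ((hasDerivAt_id v).mul_const _).const_sub 1
    have h2 := (h1.inv (hne v hv ξ)).const_mul (Complex.exp (vline ξ) * vline ξ ^ (-(β : ℂ)))
    refine (h2.congr_deriv ?_).congr_of_eventuallyEq (Eventually.of_forall fun y ↦ ?_)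
    · ring
    · simp [mittagLefflerKernel, div_eq_mul_inv]

theorem Real.cos_le_cos_of_le_abs {η θ : ℝ} (hη : 0 ≤ η) (h1 : η ≤ |θ|)
    (h2 : |θ| ≤ 2 * Real.pi - η) : Real.cos θ ≤ Real.cos η := by
  rw [← Real.cos_abs θ]
  rcases le_total |θ| Real.pi with h | h
  · exact Real.cos_le_cos_of_nonneg_of_le_pi hη h h1
  · rw [← Real.cos_two_pi_sub |θ|]
    exact Real.cos_le_cos_of_nonneg_of_le_pi hη (by linarith) (by linarith)

/-- Multiplication by `u ^ (-α)` with `re u = 1` maps the sector `|arg z| ≥ μ` into the sector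
`|arg z| ≥ μ - πα/2`. -/
theorem re_mul_vline_cpow_le {α μ : ℝ} (hα0 : 0 < α) (hμ1 : Real.pi * α / 2 < μ)
    (hμ2 : μ < Real.pi) {z : ℂ} (hz : z.re ≤ ‖z‖ * Real.cos μ) (ξ : ℝ) :
    (z * vline ξ ^ (-(α : ℂ))).re ≤
      ‖z * vline ξ ^ (-(α : ℂ))‖ * Real.cos (μ - Real.pi * α / 2) := by
  rcases eq_or_ne z 0 with rfl | hz0
  · simp
  have hπα : 0 < Real.pi * α := mul_pos Real.pi_pos hα0
  have hargz : μ ≤ |z.arg| := by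
    by_contra! h
    have h1 := Real.cos_lt_cos_of_nonneg_of_le_pi (abs_nonneg z.arg) hμ2.le h
    rw [Real.cos_abs] at h1
    have h2 := Complex.norm_mul_cos_arg z
    nlinarith [norm_pos_iff.mpr hz0]
  have hargu : |α * (vline ξ).arg| ≤ Real.pi * α / 2 := by
    have := Complex.abs_arg_lt_pi_div_two_iff.mpr (Or.inl (by simp [vline_re]) : 0 < (vline ξ).re ∨ _)
    rw [abs_mul, abs_of_pos hα0]
    nlinarith
  have hpolar : z * vline ξ ^ (-(α : ℂ)) = ((‖z‖ * ‖vline ξ‖ ^ (-α) : ℝ) : ℂ) *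
      Complex.exp (((z.arg - α * (vline ξ).arg : ℝ) : ℂ) * Complex.I) := by
    conv_lhs => rw [← Complex.norm_mul_exp_arg_mul_I z]
    rw [Complex.cpow_def_of_ne_zero (vline_ne_zero ξ), Real.rpow_def_of_pos
      (norm_pos_iff.mpr (vline_ne_zero ξ)), Complex.log]
    push_cast
    rw [mul_assoc, mul_assoc, ← Complex.exp_add, ← Complex.exp_add]
    congr 2
    ring
  have hnn : 0 ≤ ‖z‖ * ‖vline ξ‖ ^ (-α) := by positivity
  rw [hpolar, Complex.re_ofReal_mul, Complex.exp_ofReal_mul_I_re, norm_mul,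
    Complex.norm_exp_ofReal_mul_I, mul_one, Complex.norm_of_nonneg hnn]
  refine mul_le_mul_of_nonneg_left (Real.cos_le_cos_of_le_abs (by linarith) ?_ ?_) hnn
  · have := abs_sub_abs_le_abs_sub z.arg (α * (vline ξ).arg)
    linarith
  · have := abs_sub z.arg (α * (vline ξ).arg)
    linarith [Complex.abs_arg_le_pi z]

theorem sin_mul_max_le_norm_one_sub {η : ℝ} {w : ℂ} (hw : w.re ≤ ‖w‖ * Real.cos η) :
    Real.sin η * max 1 ‖w‖ ≤ ‖1 - w‖ := by
  have hsq : ‖1 - w‖ ^ 2 = 1 - 2 * w.re + ‖w‖ ^ 2 := by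
    rw [Complex.sq_norm, Complex.sq_norm, Complex.normSq_apply, Complex.normSq_apply]
    simp
    ring
  have hsc := Real.sin_sq_add_cos_sq η
  refine le_of_sq_le_sq ?_ (norm_nonneg _)
  rw [hsq]
  rcases max_cases 1 ‖w‖ with ⟨h, -⟩ | ⟨h, -⟩ <;> rw [h]
  · nlinarith [sq_nonneg (‖w‖ - Real.cos η)]
  · nlinarith [sq_nonneg (1 - ‖w‖ * Real.cos η)]

theorem mittagLeffler_eq_integral {α β μ : ℝ} (hα0 : 0 < α) (hβ : 1 < β)
    (hμ1 : Real.pi * α / 2 < μ) (hμ2 : μ < Real.pi) {z : ℂ} (hz : z.re ≤ ‖z‖ * Real.cos μ) :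
    mittagLeffler α β z = ∫ ξ, mittagLefflerKernel α β z ξ := by
  have hπα : 0 < Real.pi * α := mul_pos Real.pi_pos hα0
  have hsin : 0 < Real.sin (μ - Real.pi * α / 2) :=
    Real.sin_pos_of_pos_of_lt_pi (by linarith) (by linarith)
  have hE : AnalyticOnNhd ℂ (mittagLeffler α β) (segment ℝ 0 z) := fun w _ ↦
    (differentiable_mittagLeffler hα0 (by linarith)).analyticAt w
  refine hE.eqOn_of_preconnected_of_eventuallyEq
    (g := fun z ↦ ∫ ξ, mittagLefflerKernel α β z ξ) (fun w hw ↦ ?_)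
    (convex_segment 0 z).isPreconnected (left_mem_segment ℝ 0 z) ?_ (right_mem_segment ℝ 0 z)
  · refine analyticAt_integral_mittagLefflerKernel hα0 hβ hsin fun ξ ↦ ?_
    rw [segment_eq_image] at hw
    obtain ⟨t, ht, rfl⟩ := hw
    have ht' : (t • z).re ≤ ‖t • z‖ * Real.cos μ := by
      rw [norm_smul, Real.norm_of_nonneg ht.1, Complex.smul_re, smul_eq_mul, mul_assoc]
      exact mul_le_mul_of_nonneg_left hz ht.1
    have h := sin_mul_max_le_norm_one_sub (re_mul_vline_cpow_le hα0 hμ1 hμ2 ht' ξ)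
    simp only [smul_zero, zero_add]
    exact le_trans (le_mul_of_one_le_right hsin.le (le_max_left _ _)) h
  · filter_upwards [Metric.ball_mem_nhds (0 : ℂ) one_pos] with w hw
    exact mittagLeffler_eq_integral_of_norm_lt_one hα0 hβ (by simpa using hw)

/-- Decay of `E_{α,β}` away from the positive real axis, at rate `1 / |z|`. -/
def MittagLefflerDecay (α β : ℝ) : Prop :=
  ∀ μ : ℝ, Real.pi * α / 2 < μ → μ < Real.pi →
    ∃ C, ∀ z : ℂ, z.re ≤ ‖z‖ * Real.cos μ → ‖z‖ * ‖mittagLeffler α β z‖ ≤ C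

theorem mittagLefflerDecay_of_large {α β : ℝ} (hα0 : 0 < α) (hβ : α + 1 < β) :
    MittagLefflerDecay α β := by
  intro μ hμ1 hμ2
  have hπα : 0 < Real.pi * α := mul_pos Real.pi_pos hα0
  have hsin : 0 < Real.sin (μ - Real.pi * α / 2) :=
    Real.sin_pos_of_pos_of_lt_pi (by linarith) (by linarith)
  have hint := (integrable_norm_vline_rpow (s := β - α) (by linarith)).const_mul
    (Real.exp 1 / Real.sin (μ - Real.pi * α / 2))
  refine ⟨∫ ξ, Real.exp 1 / Real.sin (μ - Real.pi * α / 2) * ‖vline ξ‖ ^ (-(β - α)),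
    fun z hz ↦ ?_⟩
  rw [mittagLeffler_eq_integral hα0 (by linarith) hμ1 hμ2 hz, ← norm_mul, ← integral_const_mul]
  refine norm_integral_le_of_norm_le hint (Eventually.of_forall fun ξ ↦ ?_)
  have hu : 0 < ‖vline ξ‖ := norm_pos_iff.mpr (vline_ne_zero ξ)
  have h := sin_mul_max_le_norm_one_sub (re_mul_vline_cpow_le hα0 hμ1 hμ2 hz ξ)
  have h1 : 0 < ‖1 - z * vline ξ ^ (-(α : ℂ))‖ :=
    (mul_pos hsin (lt_max_of_lt_left one_pos)).trans_le h
  have h2 : Real.sin (μ - Real.pi * α / 2) * (‖z‖ * ‖vline ξ‖ ^ (-α)) ≤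
      ‖1 - z * vline ξ ^ (-(α : ℂ))‖ := by
    rw [← norm_vline_cpow, Complex.ofReal_neg, ← norm_mul]
    exact (mul_le_mul_of_nonneg_left (le_max_right _ _) hsin.le).trans h
  have h3 : ‖vline ξ‖ ^ (-β) = ‖vline ξ‖ ^ (-(β - α)) * ‖vline ξ‖ ^ (-α) := by
    rw [← Real.rpow_add hu]
    congr 1
    ring
  rw [mittagLefflerKernel, norm_mul, norm_div, norm_exp_mul_vline_cpow, ← mul_div_assoc,
    div_le_iff₀ h1]
  calc ‖z‖ * (Real.exp 1 * ‖vline ξ‖ ^ (-β))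
      = Real.exp 1 / Real.sin (μ - Real.pi * α / 2) * ‖vline ξ‖ ^ (-(β - α)) *
        (Real.sin (μ - Real.pi * α / 2) * (‖z‖ * ‖vline ξ‖ ^ (-α))) := by
        rw [h3]
        generalize Real.sin (μ - Real.pi * α / 2) = c at hsin ⊢
        field_simp
    _ ≤ _ := by gcongr

theorem MittagLefflerDecay.of_add_one {α β : ℝ} (hα0 : 0 < α) (hβ : 0 < β)
    (h : MittagLefflerDecay α (β + 1)) : MittagLefflerDecay α β := by
  intro μ hμ1 hμ2
  have hπα : 0 < Real.pi * α := mul_pos Real.pi_pos hα0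
  set ν : ℝ := (Real.pi * α / 2 + μ) / 2 with hν
  obtain ⟨C, hC⟩ := h ν (by linarith) (by linarith)
  have hcos : Real.cos μ < Real.cos ν :=
    Real.cos_lt_cos_of_nonneg_of_le_pi (by linarith) hμ2.le (by linarith)
  set ε : ℝ := (Real.cos ν - Real.cos μ) / 4 with hε
  have hε0 : 0 < ε := by linarith
  have hε1 : ε ≤ 1 / 2 := by linarith [Real.cos_le_one ν, Real.neg_one_le_cos μ]
  refine ⟨β * C + α * (2 * C / ε), fun z hz ↦ ?_⟩
  have hC0 : 0 ≤ C := by simpa using hC 0 (by simp)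
  rcases eq_or_ne z 0 with rfl | hz0
  · rw [norm_zero, zero_mul]
    positivity
  have hzpos : 0 < ‖z‖ := norm_pos_iff.mpr hz0
  have hzν : z.re ≤ ‖z‖ * Real.cos ν := hz.trans (by gcongr)
  have hderiv : ‖deriv (mittagLeffler α (β + 1)) z‖ ≤ 2 * C / ‖z‖ / (ε * ‖z‖) := by
    refine Complex.norm_deriv_le_of_forall_mem_sphere_norm_le (by positivity)
      (differentiable_mittagLeffler hα0 (by linarith)).diffContOnCl fun w hw ↦ ?_
    have hwz : ‖w - z‖ = ε * ‖z‖ := by rwa [mem_sphere_iff_norm] at hw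
    have hre : w.re - z.re ≤ ε * ‖z‖ := by
      rw [← hwz, ← Complex.sub_re]
      exact Complex.re_le_norm _
    have habs : |‖w‖ - ‖z‖| ≤ ε * ‖z‖ := hwz ▸ abs_norm_sub_norm_le w z
    have hwν : w.re ≤ ‖w‖ * Real.cos ν := by
      have h1 : |(‖w‖ - ‖z‖) * Real.cos ν| ≤ ε * ‖z‖ := by
        rw [abs_mul]
        exact (mul_le_of_le_one_right (abs_nonneg _) (Real.abs_cos_le_one ν)).trans habs
      have h2 : ‖z‖ * Real.cos ν = ‖z‖ * Real.cos μ + 4 * (ε * ‖z‖) := by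
        rw [hε]
        ring
      linarith [neg_le_of_abs_le h1, mul_pos hε0 hzpos]
    have hw2 : ‖z‖ / 2 ≤ ‖w‖ := by
      have := neg_le_of_abs_le habs
      nlinarith
    have hw1 := hC w hwν
    rw [le_div_iff₀ hzpos]
    nlinarith [norm_nonneg (mittagLeffler α (β + 1) w)]
  have hbase := hC z hzν
  calc ‖z‖ * ‖mittagLeffler α β z‖
      ≤ ‖z‖ * (β * ‖mittagLeffler α (β + 1) z‖ +
        α * ‖z‖ * ‖deriv (mittagLeffler α (β + 1)) z‖) := by
        rw [mittagLeffler_eq_add_deriv hα0 hβ]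
        gcongr
        refine (norm_add_le _ _).trans (le_of_eq ?_)
        rw [norm_mul, norm_mul, norm_mul, Complex.norm_of_nonneg hβ.le,
          Complex.norm_of_nonneg hα0.le]
    _ ≤ ‖z‖ * (β * ‖mittagLeffler α (β + 1) z‖ +
        α * ‖z‖ * (2 * C / ‖z‖ / (ε * ‖z‖))) := by gcongr
    _ = β * (‖z‖ * ‖mittagLeffler α (β + 1) z‖) + α * (2 * C / ε) := by
        field_simp
    _ ≤ β * C + α * (2 * C / ε) := by gcongr

theorem mittagLefflerDecay {α β : ℝ} (hα0 : 0 < α) (hα2 : α < 2) (hβ : 0 < β) :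
    MittagLefflerDecay α β :=
  .of_add_one hα0 hβ <| .of_add_one hα0 (by linarith) <| .of_add_one hα0 (by linarith) <|
    mittagLefflerDecay_of_large hα0 (by linarith)

/-- For `0 < α < 2`, `β > 0` and `πα/2 < μ < min{π, πα}`, there is a constant
`C = C(α, β, μ) > 0` such that `|E_{α,β}(z)| ≤ C / (1 + |z|)` whenever
`μ ≤ |arg z| ≤ π` (with `arg` the principal argument, so `|arg z| ≤ π` always). -/
theorem mittagLeffler_bound_in_sector (α β μ : ℝ) (hα0 : 0 < α) (hα2 : α < 2)
    (hβ : 0 < β) (hμ1 : Real.pi * α / 2 < μ) (hμ2 : μ < min Real.pi (Real.pi * α)) :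
    ∃ C > 0, ∀ z : ℂ, z ≠ 0 → μ ≤ |z.arg| → |z.arg| ≤ Real.pi →
      ‖mittagLeffler α β z‖ ≤ C / (1 + ‖z‖) := by
  obtain ⟨C, hC⟩ := mittagLefflerDecay hα0 hα2 hβ μ hμ1 (hμ2.trans_le (min_le_left _ _))
  obtain ⟨M, hM⟩ := (isCompact_closedBall (0 : ℂ) 1).exists_bound_of_continuousOn
    (differentiable_mittagLeffler hα0 hβ).continuous.continuousOn
  have hM0 : 0 ≤ M := (norm_nonneg _).trans (hM 0 (by simp))
  have hC0 : 0 ≤ C := by simpa using hC 0 (by simp)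
  have hμ0 : 0 ≤ μ := by
    have := mul_pos Real.pi_pos hα0
    linarith
  refine ⟨2 * M + 2 * C + 1, by positivity, fun z _ hz1 hz2 ↦ ?_⟩
  have hzμ : z.re ≤ ‖z‖ * Real.cos μ := by
    rw [← Complex.norm_mul_cos_arg z, ← Real.cos_abs z.arg]
    gcongr
    exact Real.cos_le_cos_of_nonneg_of_le_pi hμ0 hz2 hz1
  have hz := hC z hzμ
  have hE := norm_nonneg (mittagLeffler α β z)
  rw [le_div_iff₀ (by positivity)]
  rcases le_total ‖z‖ 1 with h | h
  · have := hM z (by simpa using h)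
    nlinarith
  · nlinarith
end

section
/- For every 0 < α < 1 and λ > 0, the function t ↦ E_{α,1}(−λ t^α) is completely monotone on (0, ∞): for every integer n ≥ 0 and every t > 0, (−1)^n (d/dt)^n E_{α,1}(−λ t^α) ≥ 0. -/
/-- The real Mittag-Leffler function `E_{α,β}(x) = ∑_{k=0}^∞ x^k / Γ(αk + β)`. -/
noncomputable def mittagLefflerReal (α β : ℝ) (x : ℝ) : ℝ :=
  ∑' k : ℕ, x ^ k / Real.Gamma (α * (k : ℝ) + β)

open Filter Topology MeasureTheory Set

/-- `AlternatingDiff n f`: all `n`-fold iterated backward differences of `f` on `(0, ∞)`,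
with arbitrary positive steps, are nonnegative. -/
def AlternatingDiff : ℕ → (ℝ → ℝ) → Prop
  | 0, f => ∀ t, 0 < t → 0 ≤ f t
  | n + 1, f => ∀ h, 0 < h → AlternatingDiff n (fun t => f t - f (t + h))

namespace AlternatingDiff

lemma of_tendsto {ι : Type*} {l : Filter ι} [l.NeBot] {n : ℕ} {F : ι → ℝ → ℝ} {f : ℝ → ℝ}
    (hF : ∀ᶠ i in l, AlternatingDiff n (F i))
    (hlim : ∀ t, 0 < t → Tendsto (fun i => F i t) l (𝓝 (f t))) : AlternatingDiff n f := by
  induction n generalizing F f with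
  | zero =>
    intro t ht
    exact ge_of_tendsto (hlim t ht) (hF.mono fun i hi => hi t ht)
  | succ n ih =>
    intro h hh
    refine ih (F := fun i t => F i t - F i (t + h)) (hF.mono fun i hi => hi h hh) ?_
    intro t ht
    exact (hlim t ht).sub (hlim (t + h) (by positivity))

lemma congr {n : ℕ} {f g : ℝ → ℝ} (hf : AlternatingDiff n f)
    (hfg : ∀ t, 0 < t → f t = g t) : AlternatingDiff n g := by
  refine of_tendsto (l := (pure () : Filter Unit)) (F := fun _ => f)
    (Eventually.of_forall fun _ => hf) ?_
  intro t ht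
  rw [hfg t ht]
  exact tendsto_const_nhds

lemma add {n : ℕ} {f g : ℝ → ℝ} (hf : AlternatingDiff n f) (hg : AlternatingDiff n g) :
    AlternatingDiff n (fun t => f t + g t) := by
  induction n generalizing f g with
  | zero => exact fun t ht => add_nonneg (hf t ht) (hg t ht)
  | succ n ih =>
    intro h hh
    exact (ih (hf h hh) (hg h hh)).congr fun t _ => by ring

lemma const_mul {n : ℕ} {f : ℝ → ℝ} {c : ℝ} (hc : 0 ≤ c) (hf : AlternatingDiff n f) :
    AlternatingDiff n (fun t => c * f t) := by
  induction n generalizing f with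
  | zero => exact fun t ht => mul_nonneg hc (hf t ht)
  | succ n ih =>
    intro h hh
    exact (ih (hf h hh)).congr fun t _ => by ring

lemma shift {n : ℕ} {f : ℝ → ℝ} {u : ℝ} (hu : 0 ≤ u) (hf : AlternatingDiff n f) :
    AlternatingDiff n (fun t => f (t + u)) := by
  induction n generalizing f with
  | zero => exact fun t ht => hf _ (by positivity)
  | succ n ih =>
    intro h hh
    exact (ih (hf h hh)).congr fun t _ => by ring_nf

lemma mul {n : ℕ} {f g : ℝ → ℝ} (hf : ∀ k ≤ n, AlternatingDiff k f)
    (hg : ∀ k ≤ n, AlternatingDiff k g) : AlternatingDiff n (fun t => f t * g t) := by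
  induction n generalizing f g with
  | zero => exact fun t ht => mul_nonneg (hf 0 le_rfl t ht) (hg 0 le_rfl t ht)
  | succ n ih =>
    intro h hh
    have h1 := ih (f := fun t => f t - f (t + h)) (g := g)
      (fun k hk => hf (k + 1) (by omega) h hh) (fun k hk => hg k (by omega))
    have h2 := ih (f := fun t => f (t + h)) (g := fun t => g t - g (t + h))
      (fun k hk => (hf k (by omega)).shift hh.le) (fun k hk => hg (k + 1) (by omega) h hh)
    exact (h1.add h2).congr fun t _ => by ring

lemma integral {X : Type*} [MeasurableSpace X] {μ : Measure X} {n : ℕ} {F : X → ℝ → ℝ}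
    (hF : ∀ᵐ x ∂μ, AlternatingDiff n (F x))
    (hint : ∀ t, 0 < t → Integrable (fun x => F x t) μ) :
    AlternatingDiff n (fun t => ∫ x, F x t ∂μ) := by
  induction n generalizing F with
  | zero => exact fun t ht => integral_nonneg_of_ae (hF.mono fun x hx => hx t ht)
  | succ n ih =>
    intro h hh
    refine (ih (F := fun x t => F x t - F x (t + h)) (hF.mono fun x hx => hx h hh)
      fun t ht => (hint t ht).sub (hint (t + h) (by positivity))).congr fun t ht => ?_
    exact integral_sub (hint t ht) (hint (t + h) (by positivity))

lemma intervalIntegral {n : ℕ} {F : ℝ → ℝ → ℝ} {b : ℝ} (hb : 0 ≤ b)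
    (hF : ∀ x, 0 < x → AlternatingDiff n (F x))
    (hint : ∀ t, 0 < t → IntervalIntegrable (fun x => F x t) volume 0 b) :
    AlternatingDiff n (fun t => ∫ x in (0 : ℝ)..b, F x t) := by
  simp only [intervalIntegral.integral_of_le hb]
  refine integral ?_ fun t ht => (hint t ht).1
  exact (ae_restrict_iff' measurableSet_Ioc).2 (Eventually.of_forall fun x hx => hF x hx.1)

/-- If `-f'` satisfies the `n`-th difference condition, then `f` satisfies the next one. -/
lemma succ_of_hasDerivAt {n : ℕ} {f g : ℝ → ℝ} (hg : AlternatingDiff n g)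
    (hcont : ContinuousOn g (Ioi 0)) (hderiv : ∀ t, 0 < t → HasDerivAt f (-g t) t) :
    AlternatingDiff (n + 1) f := by
  intro h hh
  have hint : ∀ t, 0 < t → IntervalIntegrable (fun u => g (t + u)) volume 0 h := by
    intro t ht
    apply ContinuousOn.intervalIntegrable
    rw [uIcc_of_le hh.le]
    exact hcont.comp (by fun_prop) fun u hu => by
      have := hu.1
      simp only [mem_Ioi]
      positivity
  refine (intervalIntegral (F := fun u t => g (t + u)) hh.le
    (fun u hu => hg.shift hu.le) hint).congr fun t ht => ?_
  have := intervalIntegral.integral_eq_sub_of_hasDerivAt (f := fun u => -f (t + u))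
    (f' := fun u => g (t + u)) (a := 0) (b := h) ?_ (hint t ht)
  · rw [this]
    simp only [add_zero]
    ring
  · intro u hu
    rw [uIcc_of_le hh.le] at hu
    have := (hderiv (t + u) (by linarith [hu.1])).comp_const_add t u
    simpa using this.fun_neg

lemma neg_deriv {n : ℕ} {f : ℝ → ℝ} (hf : AlternatingDiff (n + 1) f)
    (hd : ∀ t, 0 < t → DifferentiableAt ℝ f t) : AlternatingDiff n (-deriv f) := by
  refine of_tendsto (l := 𝓝[>] (0 : ℝ)) (F := fun h t => h⁻¹ * (f t - f (t + h))) ?_ ?_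
  · filter_upwards [self_mem_nhdsWithin] with h hh
    exact (hf h hh).const_mul (inv_nonneg.2 (le_of_lt hh))
  · intro t ht
    have := (hd t ht).hasDerivAt.tendsto_slope_zero_right.neg
    refine this.congr fun h => ?_
    simp only [smul_eq_mul]
    ring

lemma iteratedDeriv_nonneg {n : ℕ} {f : ℝ → ℝ} (hf : AlternatingDiff n f)
    (hs : ContDiffOn ℝ n f (Ioi 0)) {t : ℝ} (ht : 0 < t) :
    0 ≤ (-1 : ℝ) ^ n * iteratedDeriv n f t := by
  induction n generalizing f with
  | zero => simpa using hf t ht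
  | succ n ih =>
    have hd : ∀ t, 0 < t → DifferentiableAt ℝ f t := fun t ht =>
      (hs.differentiableOn (by simp)).differentiableAt (Ioi_mem_nhds ht)
    have hs' : ContDiffOn ℝ n (-deriv f) (Ioi 0) :=
      (hs.deriv_of_isOpen isOpen_Ioi (by norm_cast)).neg
    have := ih (hf.neg_deriv hd) hs'
    rw [iteratedDeriv_neg] at this
    rw [iteratedDeriv_succ', pow_succ]
    linarith

lemma rpow_neg (n : ℕ) {p : ℝ} (hp : 0 < p) : AlternatingDiff n (fun t => t ^ (-p)) := by
  induction n generalizing p with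
  | zero => exact fun t ht => (Real.rpow_pos_of_pos ht _).le
  | succ n ih =>
    refine succ_of_hasDerivAt (g := fun t => p * t ^ (-(p + 1)))
      ((ih (by positivity)).const_mul hp.le) ?_ fun t ht => ?_
    · exact continuousOn_const.mul (continuousOn_id.rpow_const fun x hx => Or.inl (ne_of_gt hx))
    · have := Real.hasDerivAt_rpow_const (p := -p) (Or.inl ht.ne')
      convert this using 1
      ring_nf

lemma exp_neg_rpow (n : ℕ) {α c : ℝ} (hα0 : 0 < α) (hα1 : α < 1) (hc : 0 ≤ c) :
    AlternatingDiff n (fun t => Real.exp (-(c * t ^ α))) := by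
  induction n using Nat.strong_induction_on with
  | _ n ih =>
    cases n with
    | zero => exact fun t _ => (Real.exp_pos _).le
    | succ n =>
      refine succ_of_hasDerivAt
        (g := fun t => (c * α * t ^ (-(1 - α))) * Real.exp (-(c * t ^ α)))
        (mul (fun k _ => (rpow_neg k (by linarith)).const_mul (by positivity))
          fun k hk => ih k (by omega)) ?_ fun t ht => ?_
      · have h1 : ∀ q : ℝ, ContinuousOn (fun t : ℝ => t ^ q) (Ioi 0) := fun q =>
          continuousOn_id.rpow_const fun x hx => Or.inl (ne_of_gt hx)
        exact (continuousOn_const.mul (h1 _)).mul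
          (Real.continuous_exp.comp_continuousOn (continuousOn_const.mul (h1 _)).neg)
      · have := (((Real.hasDerivAt_rpow_const (p := α) (Or.inl ht.ne')).const_mul c).fun_neg).exp
        convert this using 1
        rw [neg_sub]
        ring

end AlternatingDiff

lemma contDiff_tsum_mul_pow {a : ℕ → ℝ} (ha : ∀ r : ℝ, 0 ≤ r → Summable fun k => |a k| * r ^ k)
    (n : ℕ) : ContDiff ℝ n (fun x : ℝ => ∑' k, a k * x ^ k) := by
  let p := FormalMultilinearSeries.ofScalars ℝ a
  have hp : p.radius = ⊤ := by
    apply FormalMultilinearSeries.radius_eq_top_of_summable_norm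
    intro r
    simpa [p, FormalMultilinearSeries.ofScalars_norm] using ha r r.2
  have h := (p.hasFPowerSeriesOnBall (by simp [hp])).analyticOnNhd
  rw [hp, Metric.eball_top] at h
  have h2 : p.sum = fun x : ℝ => ∑' k, a k * x ^ k := by
    have := FormalMultilinearSeries.ofScalarsSum_eq_tsum (E := ℝ) a
    simp only [smul_eq_mul] at this
    exact this
  rw [h2] at h
  exact h.contDiff

namespace MittagLefflerApprox

/-- The `k`-th moment of a product of `n` independent variables, the `j`-th of which is `1` with
probability `α` and otherwise has density `j * u ^ (j - 1)` on `[0, 1]`. -/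
noncomputable def moment (α : ℝ) (n k : ℕ) : ℝ :=
  ∏ j ∈ Finset.range n, ((j : ℝ) + 1 + α * k) / (j + 1 + k)

/-- The moment generating function with moments `moment α n k`. -/
noncomputable def mgf (α : ℝ) (n : ℕ) (x : ℝ) : ℝ :=
  ∑' k : ℕ, (moment α n k / (k.factorial : ℝ)) * x ^ k

variable {α : ℝ}

lemma moment_nonneg (hα0 : 0 < α) (n k : ℕ) : 0 ≤ moment α n k :=
  Finset.prod_nonneg fun j _ => by positivity

lemma moment_le_one (hα0 : 0 < α) (hα1 : α < 1) (n k : ℕ) : moment α n k ≤ 1 := by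
  refine Finset.prod_le_one (fun j _ => by positivity) fun j _ => ?_
  rw [div_le_one (by positivity)]
  nlinarith [(Nat.cast_nonneg k : (0 : ℝ) ≤ k)]

lemma summable_abs_coeff (hα0 : 0 < α) (hα1 : α < 1) (n : ℕ) (r : ℝ) (hr : 0 ≤ r) :
    Summable fun k : ℕ => |moment α n k / (k.factorial : ℝ)| * r ^ k := by
  refine Summable.of_nonneg_of_le (fun k => by positivity) (fun k => ?_)
    (Real.summable_pow_div_factorial r)
  rw [abs_of_nonneg (div_nonneg (moment_nonneg hα0 n k) (by positivity)), div_mul_eq_mul_div]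
  gcongr
  exact mul_le_of_le_one_left (by positivity) (moment_le_one hα0 hα1 n k)

lemma continuous_mgf (hα0 : 0 < α) (hα1 : α < 1) (n : ℕ) : Continuous (mgf α n) :=
  (contDiff_tsum_mul_pow (summable_abs_coeff hα0 hα1 n) 0).continuous

lemma hasSum_mgf (hα0 : 0 < α) (hα1 : α < 1) (n : ℕ) (x : ℝ) :
    HasSum (fun k : ℕ => (moment α n k / (k.factorial : ℝ)) * x ^ k) (mgf α n x) := by
  refine Summable.hasSum (Summable.of_norm ?_)
  simpa only [norm_mul, norm_pow, Real.norm_eq_abs] using summable_abs_coeff hα0 hα1 n |x| (abs_nonneg x)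

lemma mgf_zero (x : ℝ) : mgf α 0 x = Real.exp x := by
  rw [Real.exp_eq_exp_ℝ, NormedSpace.exp_eq_tsum_div]
  simp [mgf, moment, div_eq_inv_mul]

lemma mgf_succ (hα0 : 0 < α) (hα1 : α < 1) (n : ℕ) (x : ℝ) :
    mgf α (n + 1) x = α * mgf α n x +
      (1 - α) * ∫ u in (0 : ℝ)..1, ((n + 1) * u ^ n) * mgf α n (x * u) := by
  have hint : HasSum (fun k : ℕ => ∫ u in (0 : ℝ)..1, ((n + 1) * u ^ n) *
        ((moment α n k / (k.factorial : ℝ)) * (x * u) ^ k))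
      (∫ u in (0 : ℝ)..1, ((n + 1) * u ^ n) * mgf α n (x * u)) := by
    refine intervalIntegral.hasSum_integral_of_dominated_convergence
      (fun k _ => (n + 1) * (|moment α n k / (k.factorial : ℝ)| * |x| ^ k))
      (fun k => Continuous.aestronglyMeasurable (by fun_prop)) ?_ ?_ ?_ ?_
    · intro k
      refine Eventually.of_forall fun u hu => ?_
      rw [uIoc_of_le zero_le_one] at hu
      have h0 := hu.1.le
      have h1 : u ^ n ≤ 1 := pow_le_one₀ h0 hu.2
      have h2 : (|x| * u) ^ k ≤ |x| ^ k := by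
        gcongr
        exact mul_le_of_le_one_right (abs_nonneg x) hu.2
      rw [Real.norm_eq_abs, abs_mul, abs_mul (_ / _), abs_pow, abs_mul x, abs_of_nonneg h0,
        abs_of_nonneg (by positivity : 0 ≤ ((n : ℝ) + 1) * u ^ n)]
      gcongr
      exact mul_le_of_le_one_right (by positivity) h1
    · exact Eventually.of_forall fun u _ =>
        (summable_abs_coeff hα0 hα1 n |x| (abs_nonneg x)).mul_left _
    · exact intervalIntegrable_const
    · exact Eventually.of_forall fun u _ => (hasSum_mgf hα0 hα1 n (x * u)).mul_left _
  have h1 := ((hasSum_mgf hα0 hα1 n x).mul_left α).add (hint.mul_left (1 - α))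
  refine (hasSum_mgf hα0 hα1 (n + 1) x).unique ?_
  refine (congrArg (fun f : ℕ → ℝ => HasSum f _) (funext fun k => ?_)).mpr h1
  have h2 : ∫ u in (0 : ℝ)..1, ((n + 1) * u ^ n) *
        ((moment α n k / (k.factorial : ℝ)) * (x * u) ^ k) =
      (n + 1) * ((moment α n k / (k.factorial : ℝ)) * x ^ k) * (1 / (n + k + 1)) := by
    have h3 : ∀ u : ℝ, ((n + 1) * u ^ n) *
        ((moment α n k / (k.factorial : ℝ)) * (x * u) ^ k) =
        (n + 1) * ((moment α n k / (k.factorial : ℝ)) * x ^ k) * u ^ (n + k) := fun u => by ring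
    simp only [h3, intervalIntegral.integral_const_mul, integral_pow]
    simp
  rw [h2, moment, Finset.prod_range_succ, ← moment]
  have : (n : ℝ) + 1 + k ≠ 0 := by positivity
  have : (n : ℝ) + k + 1 ≠ 0 := by positivity
  field_simp
  ring

lemma alternatingDiff_mgf (hα0 : 0 < α) (hα1 : α < 1) (n m : ℕ) {c : ℝ} (hc : 0 ≤ c) :
    AlternatingDiff m (fun t => mgf α n (-(c * t ^ α))) := by
  induction n generalizing c with
  | zero => simpa only [mgf_zero] using AlternatingDiff.exp_neg_rpow m hα0 hα1 hc
  | succ n ih =>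
    simp only [mgf_succ hα0 hα1]
    refine ((ih hc).const_mul hα0.le).add (AlternatingDiff.const_mul (by linarith) ?_)
    refine AlternatingDiff.intervalIntegral zero_le_one (fun u hu => ?_) fun t ht => ?_
    · refine AlternatingDiff.const_mul (by positivity)
        ((ih (c := c * u) (by positivity)).congr fun t _ => ?_)
      ring_nf
    · have := continuous_mgf hα0 hα1 n
      exact Continuous.intervalIntegrable (by fun_prop) _ _

lemma moment_mul_rpow_le (hα0 : 0 < α) (hα1 : α < 1) (n k : ℕ) :
    moment α n k * ((n : ℝ) + k + 1) ^ ((1 - α) * k) ≤ ((k : ℝ) + 1) ^ ((1 - α) * k) := by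
  induction n with
  | zero => simp [moment]
  | succ n ih =>
    refine le_trans ?_ ih
    rw [moment, Finset.prod_range_succ, ← moment, mul_assoc]
    refine mul_le_mul_of_nonneg_left ?_ (moment_nonneg hα0 n k)
    have hN : (0 : ℝ) < n + k + 1 := by positivity
    have hp : 0 ≤ (1 - α) * k := mul_nonneg (by linarith) (by positivity)
    have h1 : ((n : ℝ) + 1 + α * k) / (n + 1 + k) ≤ Real.exp (-((1 - α) * k / (n + k + 1))) := by
      refine le_trans (le_of_eq ?_) (Real.one_sub_le_exp_neg _)
      have : (n : ℝ) + 1 + k ≠ 0 := by positivity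
      field_simp
      ring
    have h2 : (((n + 1 : ℕ) : ℝ) + k + 1) ^ ((1 - α) * k) ≤
        ((n : ℝ) + k + 1) ^ ((1 - α) * k) * Real.exp ((1 - α) * k / (n + k + 1)) := by
      have h3 : (((n + 1 : ℕ) : ℝ) + k + 1) ≤ (n + k + 1) * Real.exp (1 / (n + k + 1)) := by
        have h4 := Real.add_one_le_exp (1 / ((n : ℝ) + k + 1))
        calc (((n + 1 : ℕ) : ℝ) + k + 1) = (n + k + 1) * (1 / (n + k + 1) + 1) := by
              push_cast
              field_simp
              ring
          _ ≤ _ := by gcongr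
      refine (Real.rpow_le_rpow (by positivity) h3 hp).trans (le_of_eq ?_)
      rw [Real.mul_rpow hN.le (Real.exp_pos _).le, ← Real.exp_mul]
      congr 2
      ring
    calc _ ≤ Real.exp (-((1 - α) * k / (n + k + 1))) *
          (((n : ℝ) + k + 1) ^ ((1 - α) * k) * Real.exp ((1 - α) * k / (n + k + 1))) := by
          gcongr
      _ = ((n : ℝ) + k + 1) ^ ((1 - α) * k) := by
          rw [mul_left_comm, ← Real.exp_add]
          simp

lemma moment_succ_mul_rpow_le (hα0 : 0 < α) (hα1 : α < 1) (n k : ℕ) :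
    moment α (n + 1) k * (n : ℝ) ^ ((1 - α) * k) ≤ ((k : ℝ) + 1) ^ ((1 - α) * k) := by
  refine le_trans ?_ (moment_mul_rpow_le hα0 hα1 (n + 1) k)
  refine mul_le_mul_of_nonneg_left ?_ (moment_nonneg hα0 _ k)
  refine Real.rpow_le_rpow (by positivity) ?_ (mul_nonneg (by linarith) (by positivity))
  push_cast
  linarith [(Nat.cast_nonneg k : (0 : ℝ) ≤ k)]

lemma tendsto_moment_succ_mul_rpow (hα0 : 0 < α) (k : ℕ) :
    Tendsto (fun n : ℕ => moment α (n + 1) k * (n : ℝ) ^ ((1 - α) * k)) atTop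
      (𝓝 (k.factorial / Real.Gamma (α * k + 1))) := by
  have hpos : (0 : ℝ) < α * k + 1 := by positivity
  have h := (Real.GammaSeq_tendsto_Gamma ((k : ℝ) + 1)).div
    (Real.GammaSeq_tendsto_Gamma (α * k + 1)) (Real.Gamma_pos_of_pos hpos).ne'
  rw [Real.Gamma_nat_eq_factorial] at h
  refine h.congr' ?_
  filter_upwards [eventually_gt_atTop 0] with n hn
  have hn' : (0 : ℝ) < n := by exact_mod_cast hn
  have e1 : (n : ℝ) ^ ((1 - α) * k) = (n : ℝ) ^ ((k : ℝ) + 1) / (n : ℝ) ^ (α * k + 1) := by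
    rw [← Real.rpow_sub hn']
    ring_nf
  have e2 : moment α (n + 1) k = (∏ j ∈ Finset.range (n + 1), (α * k + 1 + j)) /
      ∏ j ∈ Finset.range (n + 1), ((k : ℝ) + 1 + j) := by
    rw [moment, ← Finset.prod_div_distrib]
    refine Finset.prod_congr rfl fun j _ => ?_
    congr 1 <;> ring
  have p1 : (∏ j ∈ Finset.range (n + 1), (α * k + 1 + (j : ℝ))) ≠ 0 :=
    Finset.prod_ne_zero_iff.2 fun j _ => by positivity
  have p2 : (∏ j ∈ Finset.range (n + 1), ((k : ℝ) + 1 + (j : ℝ))) ≠ 0 :=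
    Finset.prod_ne_zero_iff.2 fun j _ => by positivity
  have p3 := (Real.rpow_pos_of_pos hn' (α * k + 1)).ne'
  have p4 : (n.factorial : ℝ) ≠ 0 := by positivity
  simp only [Pi.div_apply, Real.GammaSeq]
  rw [e1, e2]
  field_simp

lemma inv_Gamma_le (hα0 : 0 < α) (hα1 : α < 1) (k : ℕ) :
    (Real.Gamma (α * k + 1))⁻¹ ≤ ((k : ℝ) + 1) ^ ((1 - α) * k) / k.factorial := by
  have h := le_of_tendsto' (tendsto_moment_succ_mul_rpow hα0 k)
    fun n => moment_succ_mul_rpow_le hα0 hα1 n k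
  rw [le_div_iff₀ (by positivity)]
  refine le_trans (le_of_eq ?_) h
  ring

lemma summable_bound (hα0 : 0 < α) (r : ℝ) (hr : 0 ≤ r) :
    Summable fun k : ℕ => ((k : ℝ) + 1) ^ ((1 - α) * k) / k.factorial * r ^ k := by
  have hlim : Tendsto (fun k : ℕ => Real.exp 1 * r * ((k : ℝ) + 1) ^ (-α)) atTop (𝓝 0) := by
    have h1 : Tendsto (fun k : ℕ => (k : ℝ) + 1) atTop atTop :=
      tendsto_atTop_add_const_right _ _ tendsto_natCast_atTop_atTop
    simpa using ((tendsto_rpow_neg_atTop hα0).comp h1).const_mul (Real.exp 1 * r)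
  refine Summable.of_norm_bounded_eventually_nat
    ((summable_geometric_two).mul_left (Real.exp 1)) ?_
  filter_upwards [hlim.eventually_le_const (by norm_num : (0 : ℝ) < 1 / 2)] with k hk
  have hk1 : (0 : ℝ) < (k : ℝ) + 1 := by positivity
  rw [Real.norm_of_nonneg (by positivity)]
  have h1 : (1 : ℝ) / k.factorial ≤ Real.exp 1 * (Real.exp 1) ^ k / ((k : ℝ) + 1) ^ k := by
    rw [le_div_iff₀ (by positivity), ← Real.exp_nat_mul, ← Real.exp_add]
    have := Real.pow_div_factorial_le_exp ((k : ℝ) + 1) hk1.le k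
    rwa [one_div_mul_eq_div, mul_one, add_comm 1]
  have h2 : ((k : ℝ) + 1) ^ ((1 - α) * k) = ((k : ℝ) + 1) ^ k * (((k : ℝ) + 1) ^ (-α)) ^ k := by
    rw [← Real.rpow_natCast, ← Real.rpow_natCast, ← Real.rpow_mul hk1.le, ← Real.rpow_add hk1]
    ring_nf
  calc ((k : ℝ) + 1) ^ ((1 - α) * k) / k.factorial * r ^ k
      = ((k : ℝ) + 1) ^ ((1 - α) * k) * r ^ k * (1 / k.factorial) := by ring
    _ ≤ ((k : ℝ) + 1) ^ ((1 - α) * k) * r ^ k *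
        (Real.exp 1 * (Real.exp 1) ^ k / ((k : ℝ) + 1) ^ k) := by gcongr
    _ = Real.exp 1 * (Real.exp 1 * r * ((k : ℝ) + 1) ^ (-α)) ^ k := by
        rw [h2, mul_pow, mul_pow]
        field_simp
    _ ≤ Real.exp 1 * (1 / 2) ^ k := by gcongr

lemma tendsto_mgf (hα0 : 0 < α) (hα1 : α < 1) (x : ℝ) :
    Tendsto (fun n : ℕ => mgf α (n + 1) ((n : ℝ) ^ (1 - α) * x)) atTop
      (𝓝 (mittagLefflerReal α 1 x)) := by
  have hterm : ∀ n k : ℕ,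
      moment α (n + 1) k / (k.factorial : ℝ) * ((n : ℝ) ^ (1 - α) * x) ^ k =
        moment α (n + 1) k * (n : ℝ) ^ ((1 - α) * k) * (x ^ k / k.factorial) := by
    intro n k
    rw [mul_pow, Real.rpow_mul_natCast (by positivity)]
    ring
  simp only [mgf, hterm, mittagLefflerReal]
  refine tendsto_tsum_of_dominated_convergence (summable_bound hα0 |x| (abs_nonneg x)) ?_ ?_
  · intro k
    have := (tendsto_moment_succ_mul_rpow hα0 k).mul_const (x ^ k / (k.factorial : ℝ))
    convert this using 2
    have : (k.factorial : ℝ) ≠ 0 := by positivity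
    field_simp
  · refine Eventually.of_forall fun n k => ?_
    have h0 := moment_nonneg hα0 (n + 1) k
    rw [Real.norm_eq_abs, abs_mul, abs_div, abs_pow, Nat.abs_cast, abs_of_nonneg (by positivity),
      div_mul_eq_mul_div, mul_div_assoc]
    exact mul_le_mul_of_nonneg_right (moment_succ_mul_rpow_le hα0 hα1 n k) (by positivity)

lemma contDiff_mittagLefflerReal (hα0 : 0 < α) (hα1 : α < 1) (n : ℕ) :
    ContDiff ℝ n (mittagLefflerReal α 1) := by
  have h := contDiff_tsum_mul_pow (a := fun k : ℕ => (Real.Gamma (α * k + 1))⁻¹) (fun r hr => ?_) n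
  · convert h using 1
    funext x
    simp only [mittagLefflerReal, div_eq_inv_mul]
  · refine Summable.of_nonneg_of_le (fun k => by positivity) (fun k => ?_)
      (summable_bound hα0 r hr)
    have hpos : 0 < Real.Gamma (α * k + 1) := Real.Gamma_pos_of_pos (by positivity)
    rw [abs_of_pos (inv_pos.2 hpos)]
    gcongr
    exact inv_Gamma_le hα0 hα1 k

end MittagLefflerApprox

open MittagLefflerApprox in
/-- For `0 < α < 1` and `λ > 0`, the function `t ↦ E_{α,1}(−λ t^α)` is
completely monotone on `(0, ∞)`:
`(−1)^n (d/dt)^n E_{α,1}(−λ t^α) ≥ 0` for every `n ≥ 0` and `t > 0`. -/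
theorem mittagLeffler_completely_monotone (α lam : ℝ) (hα0 : 0 < α) (hα1 : α < 1)
    (hlam : 0 < lam) :
    ∀ (n : ℕ) (t : ℝ), 0 < t →
      0 ≤ (-1 : ℝ) ^ n *
        iteratedDeriv n (fun τ : ℝ => mittagLefflerReal α 1 (-(lam * τ ^ α))) t := by
  intro n t ht
  have hD : AlternatingDiff n (fun τ : ℝ => mittagLefflerReal α 1 (-(lam * τ ^ α))) := by
    refine AlternatingDiff.of_tendsto (l := atTop)
      (Eventually.of_forall fun N : ℕ => alternatingDiff_mgf hα0 hα1 (N + 1) n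
        (c := (N : ℝ) ^ (1 - α) * lam) (by positivity)) fun τ _ => ?_
    refine (tendsto_mgf hα0 hα1 (-(lam * τ ^ α))).congr fun N => ?_
    ring_nf
  refine hD.iteratedDeriv_nonneg ?_ ht
  refine (contDiff_mittagLefflerReal hα0 hα1 n).comp_contDiffOn ?_
  exact (contDiffOn_const.mul (contDiffOn_id.rpow_const_of_ne fun x hx => ne_of_gt hx)).neg
end

section
/- For every 0 < α < 1, the function x ↦ E_{α,1}(−x) is nonincreasing on [0, ∞) and satisfies 0 ≤ E_{α,1}(−x) ≤ 1 for all x ≥ 0. -/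
open Filter Topology Finset

/-- The generalized binomial coefficient `(s + 1)(s + 2)⋯(s + n) / n!`. -/
noncomputable def risingBinom (n : ℕ) (s : ℝ) : ℝ :=
  ∏ i ∈ range n, (1 + s / ((i : ℝ) + 1))

lemma risingBinom_succ (n : ℕ) (s : ℝ) :
    risingBinom (n + 1) s = risingBinom n s * (1 + s / ((n : ℝ) + 1)) :=
  prod_range_succ _ _

lemma risingBinom_pos (n : ℕ) {s : ℝ} (hs : 0 ≤ s) : 0 < risingBinom n s :=
  prod_pos fun _ _ => by positivity

/-- For `0 ≤ α ≤ 1`, the polynomial `k ↦ risingBinom n (α k)` is a nonnegative combination of the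
polynomials `k ↦ (k + m).choose m`, `m ≤ n`. -/
lemma exists_risingBinom_eq_sum_choose {α : ℝ} (hα0 : 0 ≤ α) (hα1 : α ≤ 1) (n : ℕ) :
    ∃ a : ℕ → ℝ, (∀ m, 0 ≤ a m) ∧ ∀ k : ℕ,
      risingBinom n (α * k) = ∑ m ∈ range (n + 1), a m * ((k + m).choose m : ℝ) := by
  induction n with
  | zero => exact ⟨fun _ => 1, fun _ => zero_le_one, fun k => by simp [risingBinom]⟩
  | succ n ih =>
    obtain ⟨a, ha, hk⟩ := ih
    refine ⟨fun m => (if m ≤ n then (1 - α * (m + 1) / (n + 1)) * a m else 0)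
      + α * m / (n + 1) * a (m - 1), fun m => ?_, fun k => ?_⟩
    · refine add_nonneg ?_ (mul_nonneg (by positivity) (ha _))
      split_ifs with h
      · refine mul_nonneg (sub_nonneg.2 ?_) (ha _)
        have : (m : ℝ) ≤ n := by exact_mod_cast h
        rw [div_le_one (by positivity)]
        nlinarith
      · exact le_rfl
    · have hstep : ∀ m : ℕ, ((k : ℝ) + m + 1) * ((k + m).choose m : ℝ)
          = ((m : ℝ) + 1) * ((k + (m + 1)).choose (m + 1) : ℝ) := fun m => by
        have := Nat.add_one_mul_choose_eq (k + m) m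
        rw [mul_comm ((m : ℝ) + 1)]
        exact_mod_cast this
      simp only [add_mul, sum_add_distrib]
      rw [risingBinom_succ, hk, sum_mul, sum_range_succ _ (n + 1),
        sum_range_succ' (fun m : ℕ => α * m / (n + 1) * a (m - 1) * _) (n + 1)]
      simp only [Nat.cast_zero, mul_zero, zero_div, zero_mul, add_zero,
        if_neg (Nat.not_succ_le_self n), Nat.add_sub_cancel]
      rw [← sum_add_distrib]
      refine sum_congr rfl fun m hm => ?_
      rw [if_pos (Nat.lt_succ_iff.1 (mem_range.1 hm))]
      have h := hstep m
      have hn : (n : ℝ) + 1 ≠ 0 := by positivity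
      push_cast
      field_simp
      linear_combination a m * α * h

lemma hasSum_risingBinom {α : ℝ} {n : ℕ} {a : ℕ → ℝ}
    (ha : ∀ k : ℕ, risingBinom n (α * k) = ∑ m ∈ range (n + 1), a m * ((k + m).choose m : ℝ))
    {h : ℝ} (h0 : 0 ≤ h) (h1 : h < 1) :
    HasSum (fun k : ℕ => (-h) ^ k * risingBinom n (α * k))
      (∑ m ∈ range (n + 1), a m * (1 / (1 + h) ^ (m + 1))) := by
  have hr : ‖-h‖ < 1 := by rwa [norm_neg, Real.norm_of_nonneg h0]
  have := hasSum_sum (s := range (n + 1)) fun m _ =>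
    (hasSum_choose_mul_geometric_of_norm_lt_one m hr).mul_left (a m)
  simp only [sub_neg_eq_add] at this
  refine this.congr_fun ?_
  intro k
  rw [ha, mul_sum]
  exact sum_congr rfl fun m _ => by ring

lemma risingBinom_succ_le {L : ℕ} (hL : 1 ≤ L) {s : ℝ} (hs : 0 ≤ s) {n : ℕ} (hn : L ≤ n) :
    risingBinom (n + 1) s ≤ (1 + s) ^ (L + 1) * ((n : ℝ) / L) ^ s := by
  have hL' : (0 : ℝ) < L := by exact_mod_cast hL
  induction n, hn using Nat.le_induction with
  | base =>
    rw [div_self hL'.ne', Real.one_rpow, mul_one]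
    calc risingBinom (L + 1) s ≤ ∏ _i ∈ range (L + 1), (1 + s) := by
          refine prod_le_prod (fun i _ => by positivity) fun i _ => ?_
          have : s / ((i : ℝ) + 1) ≤ s := div_le_self hs (by simp)
          linarith
      _ = _ := by simp
  | succ n hn ih =>
    have hn' : (0 : ℝ) < n := by exact_mod_cast hL.trans hn
    have hlog := Real.one_sub_inv_le_log_of_pos (x := ((n : ℝ) + 1) / n) (by positivity)
    have hfac : 1 + s / (((n + 1 : ℕ) : ℝ) + 1) ≤ (((n : ℝ) + 1) / n) ^ s := by
      rw [Real.rpow_def_of_pos (by positivity)]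
      have h1 : s / (((n + 1 : ℕ) : ℝ) + 1) ≤ s * (1 / ((n : ℝ) + 1)) := by
        rw [mul_one_div]
        push_cast
        gcongr
        linarith
      have h2 : 1 / ((n : ℝ) + 1) ≤ Real.log (((n : ℝ) + 1) / n) := by
        refine le_trans (le_of_eq ?_) hlog
        field_simp
        ring
      have h3 := mul_le_mul_of_nonneg_left h2 hs
      have h4 := Real.add_one_le_exp (Real.log (((n : ℝ) + 1) / n) * s)
      linarith
    rw [risingBinom_succ]
    calc _ ≤ (1 + s) ^ (L + 1) * ((n : ℝ) / L) ^ s * (((n : ℝ) + 1) / n) ^ s :=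
          mul_le_mul ih hfac (by positivity) (by positivity)
      _ = _ := by
        rw [mul_assoc, ← Real.mul_rpow (by positivity) (by positivity)]
        congr 2
        push_cast
        field_simp

lemma tendsto_risingBinom_div_rpow {s : ℝ} (hs : 0 ≤ s) :
    Tendsto (fun n : ℕ => risingBinom (n + 1) s / (n : ℝ) ^ s) atTop
      (𝓝 (1 / Real.Gamma (s + 1))) := by
  have hprod : ∀ n : ℕ, ∏ j ∈ range n, (s + 1 + j) = n.factorial * risingBinom n s := by
    intro n
    induction n with
    | zero => simp [risingBinom]
    | succ n ih =>
      rw [prod_range_succ, ih, risingBinom_succ, Nat.factorial_succ]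
      push_cast
      field_simp
      ring
  have h1 := (Real.GammaSeq_tendsto_Gamma (s + 1)).inv₀ (Real.Gamma_pos_of_pos (by linarith)).ne'
  have h2 := (tendsto_natCast_div_add_atTop (1 : ℝ)).mul h1
  rw [one_mul, ← one_div] at h2
  refine h2.congr' ?_
  filter_upwards [eventually_ge_atTop 1] with n hn
  have hn' : (0 : ℝ) < n := by exact_mod_cast hn
  have hp : (0 : ℝ) < (n : ℝ) ^ s := by positivity
  have hf : (n.factorial : ℝ) ≠ 0 := by positivity
  rw [Real.GammaSeq, hprod, Real.rpow_add_one hn'.ne', Nat.factorial_succ]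
  push_cast
  field_simp

/-- Euler's limit formula for `1 / Γ`, summed over the Mittag-Leffler series. -/
lemma tendsto_tsum_risingBinom {α : ℝ} (hα0 : 0 < α) {x : ℝ} (hx : 0 ≤ x) :
    Tendsto (fun n : ℕ => ∑' k : ℕ, (-(x / (n : ℝ) ^ α)) ^ k * risingBinom (n + 1) (α * k)) atTop
      (𝓝 (mittagLefflerReal α 1 (-x))) := by
  have hpow : Tendsto (fun n : ℕ => x / (n : ℝ) ^ α) atTop (𝓝 0) :=
    tendsto_const_nhds.div_atTop ((tendsto_rpow_atTop hα0).comp tendsto_natCast_atTop_atTop)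
  obtain ⟨L, hLr, hL⟩ := ((hpow.eventually (gt_mem_nhds one_pos)).and
    (eventually_ge_atTop 1)).exists
  have hL' : (0 : ℝ) < L := by exact_mod_cast hL
  set r := x / (L : ℝ) ^ α with hr
  have hr0 : 0 ≤ r := by positivity
  refine tendsto_tsum_of_dominated_convergence
    (bound := fun k : ℕ => (1 + α) ^ (L + 1) *
      (2 ^ (L + 1) * ((k : ℝ) ^ (L + 1) * r ^ k) + 2 ^ (L + 1) * r ^ k)) ?_ (fun k => ?_) ?_
  · have hrn : ‖r‖ < 1 := by rwa [Real.norm_of_nonneg hr0]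
    exact (((summable_pow_mul_geometric_of_norm_lt_one (L + 1) hrn).mul_left _).add
      ((summable_geometric_of_lt_one hr0 hLr).mul_left _)).mul_left _
  · have h := (tendsto_risingBinom_div_rpow (s := α * k) (by positivity)).const_mul ((-x) ^ k)
    rw [mul_one_div] at h
    refine h.congr fun n => ?_
    rw [Real.rpow_mul_natCast (by positivity), ← neg_div, div_pow]
    ring
  · filter_upwards [eventually_ge_atTop L] with n hn k
    have hn' : (0 : ℝ) < n := by exact_mod_cast hL.trans hn
    have hk : 0 ≤ α * k := by positivity
    rw [norm_mul, norm_pow, norm_neg, Real.norm_of_nonneg (by positivity : 0 ≤ x / (n : ℝ) ^ α),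
      Real.norm_of_nonneg (risingBinom_pos _ hk).le]
    have key : (x / (n : ℝ) ^ α) ^ k * ((n : ℝ) / L) ^ (α * k) = r ^ k := by
      rw [Real.rpow_mul_natCast (by positivity), Real.div_rpow hn'.le hL'.le, ← mul_pow, hr]
      congr 1
      have : (0 : ℝ) < (n : ℝ) ^ α := by positivity
      field_simp
    have hpoly : (1 + α * k) ^ (L + 1)
        ≤ (1 + α) ^ (L + 1) * (2 ^ (L + 1) * (k : ℝ) ^ (L + 1) + 2 ^ (L + 1)) := by
      rcases Nat.eq_zero_or_pos k with rfl | hkpos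
      · simp only [Nat.cast_zero, mul_zero, add_zero, one_pow]
        have h1 : (1 : ℝ) ≤ (1 + α) ^ (L + 1) := one_le_pow₀ (by linarith)
        have h2 : (1 : ℝ) ≤ 2 ^ (L + 1) := one_le_pow₀ (by norm_num)
        have h3 : (0 : ℝ) ≤ 2 ^ (L + 1) * 0 ^ (L + 1) := by positivity
        nlinarith
      · have hk1 : (1 : ℝ) ≤ k := by exact_mod_cast hkpos
        calc (1 + α * k) ^ (L + 1) ≤ ((1 + α) * (2 * k)) ^ (L + 1) := by
              gcongr
              nlinarith
          _ = (1 + α) ^ (L + 1) * (2 ^ (L + 1) * (k : ℝ) ^ (L + 1)) := by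
              rw [mul_pow, mul_pow]
          _ ≤ _ := by
              gcongr
              simp
    calc _ ≤ (x / (n : ℝ) ^ α) ^ k * ((1 + α * k) ^ (L + 1) * ((n : ℝ) / L) ^ (α * k)) := by
          gcongr
          exact risingBinom_succ_le hL hk hn
      _ = (1 + α * k) ^ (L + 1) * r ^ k := by rw [← key]; ring
      _ ≤ _ := mul_le_mul_of_nonneg_right hpoly (pow_nonneg hr0 k)
      _ = _ := by ring

lemma mittagLefflerReal_neg_nonneg_and_le {α : ℝ} (hα0 : 0 < α) (hα1 : α ≤ 1) {x y : ℝ}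
    (hx : 0 ≤ x) (hxy : x ≤ y) :
    0 ≤ mittagLefflerReal α 1 (-y) ∧ mittagLefflerReal α 1 (-y) ≤ mittagLefflerReal α 1 (-x) := by
  have hy := hx.trans hxy
  have hpow : Tendsto (fun n : ℕ => y / (n : ℝ) ^ α) atTop (𝓝 0) :=
    tendsto_const_nhds.div_atTop ((tendsto_rpow_atTop hα0).comp tendsto_natCast_atTop_atTop)
  have hlt := hpow.eventually (gt_mem_nhds one_pos)
  constructor
  · refine ge_of_tendsto (tendsto_tsum_risingBinom hα0 hy) ?_
    filter_upwards [hlt] with n hn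
    obtain ⟨a, ha, hk⟩ := exists_risingBinom_eq_sum_choose hα0.le hα1 (n + 1)
    rw [(hasSum_risingBinom hk (by positivity) hn).tsum_eq]
    exact sum_nonneg fun m _ => mul_nonneg (ha m) (by positivity)
  · refine le_of_tendsto_of_tendsto (tendsto_tsum_risingBinom hα0 hy)
      (tendsto_tsum_risingBinom hα0 hx) ?_
    filter_upwards [hlt] with n hn
    obtain ⟨a, ha, hk⟩ := exists_risingBinom_eq_sum_choose hα0.le hα1 (n + 1)
    have hle : x / (n : ℝ) ^ α ≤ y / (n : ℝ) ^ α := by gcongr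
    rw [(hasSum_risingBinom hk (by positivity) hn).tsum_eq,
      (hasSum_risingBinom hk (by positivity) (hle.trans_lt hn)).tsum_eq]
    refine sum_le_sum fun m _ => mul_le_mul_of_nonneg_left ?_ (ha m)
    gcongr

lemma mittagLefflerReal_one_zero (α : ℝ) : mittagLefflerReal α 1 0 = 1 := by
  rw [mittagLefflerReal, tsum_eq_single 0 fun k hk => by rw [zero_pow hk, zero_div]]
  simp

/-- For `0 < α < 1`, the function `x ↦ E_{α,1}(−x)` is nonincreasing on `[0, ∞)`
and satisfies `0 ≤ E_{α,1}(−x) ≤ 1` for all `x ≥ 0`. -/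
theorem mittagLeffler_antitone_and_bounds (α : ℝ) (hα0 : 0 < α) (hα1 : α < 1) :
    AntitoneOn (fun x : ℝ => mittagLefflerReal α 1 (-x)) (Set.Ici 0) ∧
    ∀ x : ℝ, 0 ≤ x →
      0 ≤ mittagLefflerReal α 1 (-x) ∧ mittagLefflerReal α 1 (-x) ≤ 1 := by
  refine ⟨fun x hx y _ hxy => (mittagLefflerReal_neg_nonneg_and_le hα0 hα1.le hx hxy).2,
    fun x hx => ?_⟩
  have h := mittagLefflerReal_neg_nonneg_and_le hα0 hα1.le le_rfl hx
  rwa [neg_zero, mittagLefflerReal_one_zero] at h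
end
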